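/- Assume ρ satisfies condition (3) and S is not analytic, so 0 < γ_ρ ≤ δ_ρ. For a positive integer m let ρ_m(z,w) = ρ(z, w/z^m). Then δ_{ρ_m} ≤ δ_ρ and γ_{ρ_m} ≤ γ_ρ for every m, and there exists a positive integer m with δ_{ρ_m} < δ_ρ. Moreover, for the least such m there exists an n-tuple q of harmonic polynomials such that ρ(z,q(z)) < δ_ρ for all z ∈ Γ and z^m q(z) has analytic polynomial coordinates; necessarily m ≥ 1. -/

import Mathlib

open Complex Metric MeasureTheory Filter Set

noncomputable section

/-- The unit circle `Γ` in `ℂ`. -/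
def Circ : Set ℂ := Metric.sphere (0 : ℂ) 1

/-- The closed unit disk `Δ` in `ℂ`. -/
def Disk : Set ℂ := Metric.closedBall (0 : ℂ) 1

/-- The Euclidean norm on `ℂⁿ`. -/
def euclNorm {n : ℕ} (w : Fin n → ℂ) : ℝ := Real.sqrt (∑ j, Complex.normSq (w j))

/-- The complex partial derivative `∂g/∂wⱼ` of a real-valued function `g` on `ℂⁿ`. -/
def wderiv {n : ℕ} (g : (Fin n → ℂ) → ℝ) (w : Fin n → ℂ) (j : Fin n) : ℂ :=
  (((fderiv ℝ g w) (Pi.single j 1) : ℝ) - Complex.I * ((fderiv ℝ g w) (Pi.single j Complex.I) : ℝ)) / 2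

/-- The affine complex tangent plane at `p` to the level set of `g` through `p`. -/
def TangentPlane {n : ℕ} (g : (Fin n → ℂ) → ℝ) (p : Fin n → ℂ) : Set (Fin n → ℂ) :=
  {w | ∑ j, (w j - p j) * wderiv g p j = 0}

/-- `ρ` is strictly hypoconvex on a subset `U` of `Γ × ℂⁿ`: on every compact subset
there is `𝒦 > 0` such that the real Hessian in `w` is `≥ 𝒦‖u‖²` on complex tangent
vectors `u` of the fibers. -/
def StrictHypoconvexOn {n : ℕ} (ρ : ℂ → (Fin n → ℂ) → ℝ) (U : Set (ℂ × (Fin n → ℂ))) : Prop :=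
  ∀ C : Set (ℂ × (Fin n → ℂ)), C ⊆ U → IsCompact C →
    ∃ K0 > (0:ℝ), ∀ p ∈ C, ∀ u : Fin n → ℂ,
      (∑ j, u j * wderiv (ρ p.1) p.2 j) = 0 →
      K0 * (euclNorm u)^2 ≤ iteratedFDeriv ℝ 2 (ρ p.1) p.2 ![u, u]

/-- Two subsets of real normed spaces are (C⁶-)diffeomorphic: there are C⁶ maps on
open neighborhoods carrying one onto the other, inverse to each other on the sets. -/
def DiffeomorphicSets {E F : Type*} [NormedAddCommGroup E] [NormedSpace ℝ E]
    [NormedAddCommGroup F] [NormedSpace ℝ F] (A : Set E) (B : Set F) : Prop :=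
  ∃ (U : Set E) (V : Set F) (f : E → F) (g : F → E),
    IsOpen U ∧ IsOpen V ∧ A ⊆ U ∧ B ⊆ V ∧
    ContDiffOn ℝ 6 f U ∧ ContDiffOn ℝ 6 g V ∧
    Set.MapsTo f A B ∧ Set.MapsTo g B A ∧
    (∀ x ∈ A, g (f x) = x) ∧ (∀ y ∈ B, f (g y) = y)

/-- Condition (3) of the paper, for `ρ` with respect to `R` and `S`. -/
structure Cond3 (n : ℕ) (ρ : ℂ → (Fin n → ℂ) → ℝ) (R : ℝ) (S : ℂ → Fin n → ℂ) : Prop where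
  hn : 2 ≤ n
  nonneg : ∀ z ∈ Circ, ∀ w, 0 ≤ ρ z w
  cont : ContinuousOn (fun p : ℂ × (Fin n → ℂ) => ρ p.1 p.2) {p | p.1 ∈ Circ}
  smooth : ContDiffOn ℝ 6 (fun p : ℂ × (Fin n → ℂ) => ρ p.1 p.2)
      {p | p.1 ∈ Circ ∧ ρ p.1 p.2 ≠ 0}
  hR : 1 < R
  grad_ne : ∀ z ∈ Circ, ∀ w, 0 < ρ z w → ρ z w ≤ R → fderiv ℝ (ρ z) w ≠ 0
  hypo : StrictHypoconvexOn ρ {p | p.1 ∈ Circ ∧ ρ p.1 p.2 ≠ 0}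
  levelCompact : ∀ t : ℝ, 0 < t → t ≤ R →
      IsCompact {p : ℂ × (Fin n → ℂ) | p.1 ∈ Circ ∧ ρ p.1 p.2 = t}
  fiberSphere : ∀ t : ℝ, 0 < t → t ≤ R → ∀ z ∈ Circ,
      DiffeomorphicSets {w | ρ z w = t} (Metric.sphere (0 : EuclideanSpace ℂ (Fin n)) 1)
  levelR : ∀ z ∈ Circ, ∀ w, ρ z w = R ↔ euclNorm w = R
  aboveR : ∀ z ∈ Circ, ∀ w, R < euclNorm w → R < ρ z w
  Scont : ContinuousOn S Circ
  Ssmall : ∀ z ∈ Circ, euclNorm (S z) < R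
  Szero : ∀ z ∈ Circ, ∀ w, ρ z w = 0 ↔ w = S z

/-- The `j`-th Fourier coefficient of the boundary values of `f` on the circle. -/
def bCoeff (f : ℂ → ℂ) (j : ℤ) : ℂ :=
  (1 / (2 * Real.pi) : ℂ) * ∫ θ in (0:ℝ)..(2 * Real.pi),
    f (Complex.exp (↑θ * Complex.I)) * Complex.exp (-(j : ℂ) * ↑θ * Complex.I)

/-- The Hilbert space `ℓ²(ℤ)` used to represent `W^{1,2}(Γ)`. -/
abbrev Seq2 : Type := lp (fun _ : ℤ => ℂ) 2

/-- `a ∈ ℓ²(ℤ)` is the (weighted) Fourier coefficient representation of `f` in the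
Sobolev space `W^{1,2}(Γ)`; the weight `√(1+j²)` makes the `ℓ²` norm of `a`
equivalent to the `W^{1,2}` norm of `f`. -/
def RepOf (a : Seq2) (f : ℂ → ℂ) : Prop :=
  ∀ j : ℤ, (a : ∀ _ : ℤ, ℂ) j = (Real.sqrt (1 + (j:ℝ)^2) : ℂ) * bCoeff f j

/-- Membership in `H^{1,2}(Δ) = H²(Δ) ∩ W^{1,2}(Γ)` (whose elements extend
continuously to the closed disk). -/
def MemH12 (f : ℂ → ℂ) : Prop :=
  ContinuousOn f Disk ∧ DifferentiableOn ℂ f (Metric.ball (0:ℂ) 1) ∧ ∃ a : Seq2, RepOf a f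

/-- Membership in the disk algebra `A(Δ)`. -/
def MemA (f : ℂ → ℂ) : Prop :=
  ContinuousOn f Disk ∧ DifferentiableOn ℂ f (Metric.ball (0:ℂ) 1)

/-- Membership in `H^∞(Δ)`. -/
def MemHinf (f : ℂ → ℂ) : Prop :=
  DifferentiableOn ℂ f (Metric.ball (0:ℂ) 1) ∧ ∃ M : ℝ, ∀ z ∈ Metric.ball (0:ℂ) 1, ‖f z‖ ≤ M

/-- `f` is `C^k`-smooth on the circle `Γ`. -/
def CkCirc (k : ℕ) (f : ℂ → ℂ) : Prop :=
  ContDiff ℝ k (fun θ : ℝ => f (Complex.exp (↑θ * Complex.I)))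

/-- `f` is `C⁴`-smooth on the circle `Γ`. -/
def C4Circ (f : ℂ → ℂ) : Prop := CkCirc 4 f

/-- Vector-valued versions. -/
def MemH12V {n : ℕ} (f : ℂ → Fin n → ℂ) : Prop := ∀ j, MemH12 fun z => f z j
def MemAV {n : ℕ} (f : ℂ → Fin n → ℂ) : Prop := ∀ j, MemA fun z => f z j
def MemHinfV {n : ℕ} (f : ℂ → Fin n → ℂ) : Prop := ∀ j, MemHinf fun z => f z j
def C4CircV {n : ℕ} (f : ℂ → Fin n → ℂ) : Prop := ∀ j, C4Circ fun z => f z j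

/-- The coordinates of a point of `ℂ × ℂⁿ` as a point of `ℂ^{n+1}`. -/
def pcoords {n : ℕ} (p : ℂ × (Fin n → ℂ)) : Fin (n+1) → ℂ := Fin.cons p.1 p.2

/-- The polynomial hull of a subset of `ℂ × ℂⁿ ≅ ℂ^{n+1}`. -/
def polyHull {n : ℕ} (Y : Set (ℂ × (Fin n → ℂ))) : Set (ℂ × (Fin n → ℂ)) :=
  {p | ∀ P : MvPolynomial (Fin (n+1)) ℂ, ∀ M : ℝ,
    (∀ q ∈ Y, ‖MvPolynomial.eval (pcoords q) P‖ ≤ M) → ‖MvPolynomial.eval (pcoords p) P‖ ≤ M}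

/-- The polynomial hull of a subset of `ℂⁿ`. -/
def polyHulln {n : ℕ} (Y : Set (Fin n → ℂ)) : Set (Fin n → ℂ) :=
  {w | ∀ P : MvPolynomial (Fin n) ℂ, ∀ M : ℝ,
    (∀ v ∈ Y, ‖MvPolynomial.eval v P‖ ≤ M) → ‖MvPolynomial.eval w P‖ ≤ M}

/-- The coordinates of a point of `ℂ × ℂⁿ × ℂⁿ` as a point of `ℂ^{2n+1}`. -/
def pcoords2 {n : ℕ} (p : ℂ × ((Fin n → ℂ) × (Fin n → ℂ))) : Fin (n + n + 1) → ℂ :=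
  Fin.cons p.1 (Fin.append p.2.1 p.2.2)

/-- The polynomial hull of a subset of `ℂ × ℂⁿ × ℂⁿ ≅ ℂ^{2n+1}`. -/
def polyHull2 {n : ℕ} (Y : Set (ℂ × ((Fin n → ℂ) × (Fin n → ℂ)))) :
    Set (ℂ × ((Fin n → ℂ) × (Fin n → ℂ))) :=
  {p | ∀ P : MvPolynomial (Fin (n + n + 1)) ℂ, ∀ M : ℝ,
    (∀ q ∈ Y, ‖MvPolynomial.eval (pcoords2 q) P‖ ≤ M) → ‖MvPolynomial.eval (pcoords2 p) P‖ ≤ M}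

/-- A subset of `ℂⁿ` is hypoconvex if its complement is a union of complex affine
hyperplanes. -/
def HypoconvexSet {n : ℕ} (A : Set (Fin n → ℂ)) : Prop :=
  ∀ v : Fin n → ℂ, v ∉ A → ∃ (c : Fin n → ℂ) (d : ℂ), c ≠ 0 ∧
    (∑ j, c j * v j) = d ∧ ∀ w ∈ A, (∑ j, c j * w j) ≠ d

/-- `A` has `C^k` boundary: near each boundary point the boundary is the zero set of a
`C^k` function with nonvanishing gradient. -/
def CkBoundary {E : Type*} [NormedAddCommGroup E] [NormedSpace ℝ E] (k : ℕ) (A : Set E) : Prop :=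
  ∀ p ∈ frontier A, ∃ U : Set E, IsOpen U ∧ p ∈ U ∧
    ∃ φ : E → ℝ, ContDiffOn ℝ k φ U ∧ (∀ x ∈ U, fderiv ℝ φ x ≠ 0) ∧
      frontier A ∩ U = {x | φ x = 0} ∩ U

/-- `fb` gives the a.e. radial boundary values on `Γ` of the function `f` on the open disk. -/
def IsBdryVal {n : ℕ} (f fb : ℂ → Fin n → ℂ) : Prop :=
  ∀ᵐ (θ : ℝ) ∂(volume.restrict (Set.Ioc (0:ℝ) (2 * Real.pi))),
    Filter.Tendsto (fun r : ℝ => f ((r : ℂ) * Complex.exp (↑θ * Complex.I)))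
      (nhdsWithin 1 (Set.Iio 1)) (nhds (fb (Complex.exp (↑θ * Complex.I))))

/-- The optimal control `γ_ρ = inf_{f ∈ H^∞(Δ)ⁿ} ess sup_{z ∈ Γ} ρ(z,f(z))`. -/
def gammaRho {n : ℕ} (ρ : ℂ → (Fin n → ℂ) → ℝ) : ℝ :=
  sInf {c : ℝ | ∃ f fb : ℂ → Fin n → ℂ, MemHinfV f ∧ IsBdryVal f fb ∧
    ∀ᵐ (θ : ℝ) ∂(volume.restrict (Set.Ioc (0:ℝ) (2 * Real.pi))),
      ρ (Complex.exp (↑θ * Complex.I)) (fb (Complex.exp (↑θ * Complex.I))) ≤ c}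

/-- `δ_ρ = inf_{f ∈ A(Δ)ⁿ} sup_{z ∈ Γ} ρ(z,f(z))`. -/
def deltaRho {n : ℕ} (ρ : ℂ → (Fin n → ℂ) → ℝ) : ℝ :=
  sInf {c : ℝ | ∃ f : ℂ → Fin n → ℂ, MemAV f ∧ ∀ z ∈ Circ, ρ z (f z) ≤ c}

/-- `ρ_m(z,w) = ρ(z, w/zᵐ)`. -/
def rhoShift {n : ℕ} (ρ : ℂ → (Fin n → ℂ) → ℝ) (m : ℕ) : ℂ → (Fin n → ℂ) → ℝ :=
  fun z w => ρ z (fun j => w j / z ^ m)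

/-- `q` is an `n`-tuple of harmonic polynomials. -/
def HarmPolyTuple {n : ℕ} (q : ℂ → Fin n → ℂ) : Prop :=
  ∃ (d : ℕ) (a b : ℕ → Fin n → ℂ), ∀ z : ℂ, ∀ j,
    q z j = ∑ i ∈ Finset.range (d+1), (a i j * z ^ i + b i j * (starRingEnd ℂ z) ^ i)

/-- `zᵐ q(z)` has analytic polynomial coordinates (as boundary values on `Γ`). -/
def ZmAnalytic {n : ℕ} (m : ℕ) (q : ℂ → Fin n → ℂ) : Prop :=
  ∀ j, ∃ p : Polynomial ℂ, ∀ z ∈ Circ, z ^ m * q z j = Polynomial.eval z p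

/-- The boundary function `q` on `Γ` is analytic, i.e. agrees on `Γ` with an element
of `A(Δ)ⁿ`. -/
def BoundaryAnalytic {n : ℕ} (q : ℂ → Fin n → ℂ) : Prop :=
  ∃ h : ℂ → Fin n → ℂ, MemAV h ∧ ∀ z ∈ Circ, h z = q z


/-- A.e. on the circle (parametrised by the angle). -/
abbrev angMeas : Measure ℝ := volume.restrict (Set.Ioc (0:ℝ) (2 * Real.pi))

lemma aux_bound (h : ℂ → ℂ) (hd : DifferentiableOn ℂ h (ball (0:ℂ) 1)) (B : ℝ)
    (hB : ∀ z ∈ ball (0:ℂ) 1, ‖h z‖ ≤ B) (hb : ℝ → ℂ)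
    (hlim : ∀ᵐ (θ : ℝ) ∂angMeas, Tendsto (fun r : ℝ => h ((r : ℂ) * Complex.exp (↑θ * Complex.I)))
      (nhdsWithin 1 (Set.Iio 1)) (nhds (hb θ)))
    (M : ℝ) (hM : ∀ᵐ (θ : ℝ) ∂angMeas, ‖hb θ‖ ≤ M) (a : ℂ) (ha : a ∈ ball (0:ℂ) 1) :
    ‖h a‖ ≤ M * (1 - ‖a‖)⁻¹ := by
  have ha1 : ‖a‖ < 1 := by simpa using ha
  have hmem : ∀ r : ℝ, ‖a‖ < r → r < 1 → ∀ θ : ℝ,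
      ((r : ℂ) * Complex.exp (↑θ * Complex.I)) ∈ ball (0:ℂ) 1 := by
    intro r hr hr1 θ
    have h0 : 0 ≤ r := (norm_nonneg a).trans hr.le
    simp [Complex.norm_exp_ofReal_mul_I, abs_of_nonneg h0, hr1]
  have hev : ∀ᶠ r : ℝ in nhdsWithin 1 (Set.Iio 1), ‖a‖ < r ∧ r < 1 := by
    have h1 : ∀ᶠ r : ℝ in nhdsWithin 1 (Set.Iio 1), ‖a‖ < r :=
      nhdsWithin_le_nhds (lt_mem_nhds ha1)
    have h2 : ∀ᶠ r : ℝ in nhdsWithin 1 (Set.Iio 1), r < 1 := self_mem_nhdsWithin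
    exact h1.and h2
  have hcont : ∀ r : ℝ, ‖a‖ < r → r < 1 →
      Continuous (fun θ : ℝ => ‖h ((r : ℂ) * Complex.exp (↑θ * Complex.I))‖) := by
    intro r hr hr1
    refine Continuous.norm ?_
    exact hd.continuousOn.comp_continuous (by fun_prop) (hmem r hr hr1)
  have hI : Tendsto (fun r : ℝ => ∫ θ, ‖h ((r : ℂ) * Complex.exp (↑θ * Complex.I))‖ ∂angMeas)
      (nhdsWithin 1 (Set.Iio 1)) (nhds (∫ θ, ‖hb θ‖ ∂angMeas)) := by
    refine tendsto_integral_filter_of_dominated_convergence (fun _ => B) ?_ ?_ ?_ ?_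
    · filter_upwards [hev] with r hr
      exact (hcont r hr.1 hr.2).aestronglyMeasurable
    · filter_upwards [hev] with r hr
      refine Eventually.of_forall fun θ => ?_
      rw [norm_norm]
      exact hB _ (hmem r hr.1 hr.2 θ)
    · exact integrable_const _
    · filter_upwards [hlim] with θ hθ
      exact hθ.norm
  have hIle : (∫ θ, ‖hb θ‖ ∂angMeas) ≤ 2 * Real.pi * M := by
    have := norm_integral_le_of_norm_le_const (μ := angMeas) (f := fun θ => ‖hb θ‖) (C := M)
      (by filter_upwards [hM] with θ hθ; simpa using hθ)
    have h2 := (le_abs_self _).trans this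
    refine h2.trans (le_of_eq ?_)
    simp [Measure.real, Real.pi_pos.le, mul_comm]
  have key : ∀ᶠ r : ℝ in nhdsWithin 1 (Set.Iio 1), 2 * Real.pi * ‖h a‖ ≤
      (∫ θ, ‖h ((r : ℂ) * Complex.exp (↑θ * Complex.I))‖ ∂angMeas) * (r - ‖a‖)⁻¹ := by
    filter_upwards [hev] with r hr
    have h0 : 0 < r := (norm_nonneg a).trans_lt hr.1
    have hC := (hd.mono (closedBall_subset_ball hr.2)).circleIntegral_sub_inv_smul
      (c := 0) (w := a) (by simpa using hr.1)
    have h3 := congrArg norm hC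
    rw [norm_smul] at h3
    have h4 : ‖(2 * Real.pi * I : ℂ)‖ = 2 * Real.pi := by simp [Real.pi_pos.le]
    rw [h4] at h3
    rw [← h3, circleIntegral]
    refine (intervalIntegral.norm_integral_le_integral_norm Real.two_pi_pos.le).trans ?_
    rw [intervalIntegral.integral_of_le Real.two_pi_pos.le, ← integral_mul_const]
    have hra : 0 < r - ‖a‖ := by linarith [hr.1]
    refine integral_mono_of_nonneg (Eventually.of_forall fun θ => norm_nonneg _) ?_ ?_
    · refine Integrable.mul_const ?_ _
      exact ((hcont r hr.1 hr.2).integrableOn_Icc).mono_set Ioc_subset_Icc_self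
    · refine Eventually.of_forall fun θ => ?_
      have h5 : circleMap 0 r θ = (r : ℂ) * Complex.exp (↑θ * Complex.I) := by simp [circleMap]
      have h6 : r - ‖a‖ ≤ ‖circleMap 0 r θ - a‖ := by
        have := norm_sub_norm_le (circleMap 0 r θ) a
        rwa [norm_circleMap_zero, abs_of_pos h0] at this
      simp only [norm_smul, deriv_circleMap, norm_mul, norm_circleMap_zero, norm_I, mul_one,
        abs_of_pos h0, norm_inv]
      rw [← h5]
      have h7 : ‖circleMap 0 r θ - a‖⁻¹ ≤ (r - ‖a‖)⁻¹ := inv_anti₀ hra h6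
      calc r * (‖circleMap 0 r θ - a‖⁻¹ * ‖h (circleMap 0 r θ)‖)
          ≤ 1 * ((r - ‖a‖)⁻¹ * ‖h (circleMap 0 r θ)‖) := by
            gcongr
            exact hr.2.le
        _ = _ := by ring
  have hlim2 : Tendsto (fun r : ℝ => (∫ θ, ‖h ((r : ℂ) * Complex.exp (↑θ * Complex.I))‖ ∂angMeas)
      * (r - ‖a‖)⁻¹) (nhdsWithin 1 (Set.Iio 1))
      (nhds ((∫ θ, ‖hb θ‖ ∂angMeas) * (1 - ‖a‖)⁻¹)) := by
    refine hI.mul ?_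
    refine Tendsto.inv₀ ?_ (by linarith)
    exact (tendsto_nhdsWithin_of_tendsto_nhds tendsto_id).sub_const _
  have h8 := ge_of_tendsto hlim2 key
  have h9 : 0 < (1 - ‖a‖)⁻¹ := by
    rw [inv_pos]; linarith
  have h10 : 2 * Real.pi * ‖h a‖ ≤ 2 * Real.pi * M * (1 - ‖a‖)⁻¹ :=
    h8.trans (by gcongr)
  rw [mul_assoc (2 * Real.pi)] at h10
  exact le_of_mul_le_mul_left h10 Real.two_pi_pos

/-- Maximum principle for bounded holomorphic functions with a.e. radial limits. -/
lemma maxPrinciple (h : ℂ → ℂ) (hd : DifferentiableOn ℂ h (ball (0:ℂ) 1)) (B : ℝ)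
    (hB : ∀ z ∈ ball (0:ℂ) 1, ‖h z‖ ≤ B) (hb : ℝ → ℂ)
    (hlim : ∀ᵐ (θ : ℝ) ∂angMeas, Tendsto (fun r : ℝ => h ((r : ℂ) * Complex.exp (↑θ * Complex.I)))
      (nhdsWithin 1 (Set.Iio 1)) (nhds (hb θ)))
    (M : ℝ) (hM0 : 0 < M) (hM : ∀ᵐ (θ : ℝ) ∂angMeas, ‖hb θ‖ ≤ M) (a : ℂ) (ha : a ∈ ball (0:ℂ) 1) :
    ‖h a‖ ≤ M := by
  have hk : ∀ k : ℕ, ‖h a‖ ^ k ≤ M ^ k * (1 - ‖a‖)⁻¹ := by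
    intro k
    have := aux_bound (fun z => h z ^ k) (hd.pow k) (B ^ k)
      (fun z hz => by rw [norm_pow]; exact pow_le_pow_left₀ (norm_nonneg _) (hB z hz) k)
      (fun θ => hb θ ^ k) (by filter_upwards [hlim] with θ hθ; exact hθ.pow k) (M ^ k)
      (by filter_upwards [hM] with θ hθ
          rw [norm_pow]; exact pow_le_pow_left₀ (norm_nonneg _) hθ k) a ha
    simpa using this
  by_contra! hlt
  have h1 : 1 < ‖h a‖ / M := by rwa [one_lt_div hM0]
  obtain ⟨k, hk'⟩ := pow_unbounded_of_one_lt ((1 - ‖a‖)⁻¹) h1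
  have h2 := hk k
  rw [div_pow, lt_div_iff₀ (by positivity)] at hk'
  linarith

lemma trig_dense (s : ℂ → ℂ) (hs : ContinuousOn s Circ) (ε : ℝ) (hε : 0 < ε) :
    ∃ (m : ℕ) (p : Polynomial ℂ), ∀ z ∈ Circ, ‖z ^ m * s z - p.eval z‖ ≤ ε := by
  have : Fact (0 < 2 * Real.pi) := ⟨Real.two_pi_pos⟩
  have hmem : ∀ x : AddCircle (2 * Real.pi), (AddCircle.toCircle x : ℂ) ∈ Circ := by
    intro x
    have : ‖(AddCircle.toCircle x : ℂ)‖ = 1 := Circle.norm_coe _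
    simpa [Circ] using this
  let g : C(AddCircle (2 * Real.pi), ℂ) := ⟨fun x => s (AddCircle.toCircle x),
    hs.comp_continuous (continuous_subtype_val.comp AddCircle.continuous_toCircle) hmem⟩
  have hg : g ∈ (Submodule.span ℂ (Set.range <| @fourier (2 * Real.pi))).topologicalClosure := by
    rw [span_fourier_closure_eq_top]; trivial
  rw [← SetLike.mem_coe, Submodule.topologicalClosure_coe, Metric.mem_closure_iff] at hg
  obtain ⟨t, ht, htg⟩ := hg ε hε
  have hP : ∃ (m : ℕ) (p : Polynomial ℂ), ∀ x : AddCircle (2 * Real.pi),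
      (AddCircle.toCircle x : ℂ) ^ m * t x = p.eval (AddCircle.toCircle x : ℂ) := by
    refine Submodule.span_induction (p := fun t _ => ∃ (m : ℕ) (p : Polynomial ℂ),
      ∀ x : AddCircle (2 * Real.pi),
      (AddCircle.toCircle x : ℂ) ^ m * t x = p.eval (AddCircle.toCircle x : ℂ)) ?_ ?_ ?_ ?_ ht
    · rintro _ ⟨k, rfl⟩
      refine ⟨k.natAbs, Polynomial.X ^ (k.natAbs + k).toNat, fun x => ?_⟩
      have hx : (AddCircle.toCircle x : ℂ) ≠ 0 := Circle.coe_ne_zero _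
      rw [fourier_apply, AddCircle.toCircle_zsmul, Circle.coe_zpow, ← zpow_natCast, ← zpow_add₀ hx,
        Polynomial.eval_pow, Polynomial.eval_X, ← zpow_natCast, Int.toNat_of_nonneg (by omega)]
    · exact ⟨0, 0, fun x => by simp⟩
    · rintro u v _ _ ⟨m, p, hp⟩ ⟨k, q, hq⟩
      refine ⟨m + k, Polynomial.X ^ k * p + Polynomial.X ^ m * q, fun x => ?_⟩
      simp only [ContinuousMap.add_apply, Polynomial.eval_add, Polynomial.eval_mul,
        Polynomial.eval_pow, Polynomial.eval_X, ← hp, ← hq]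
      ring
    · rintro c u _ ⟨m, p, hp⟩
      refine ⟨m, Polynomial.C c * p, fun x => ?_⟩
      simp only [ContinuousMap.smul_apply, Polynomial.eval_mul, Polynomial.eval_C, ← hp,
        smul_eq_mul]
      ring
  obtain ⟨m, p, hp⟩ := hP
  refine ⟨m, p, fun z hz => ?_⟩
  have hz1 : ‖z‖ = 1 := by simpa [Circ] using hz
  obtain ⟨x, hx⟩ : ∃ x : AddCircle (2 * Real.pi), (AddCircle.toCircle x : ℂ) = z := by
    refine ⟨((Complex.arg z : ℝ) : AddCircle (2 * Real.pi)), ?_⟩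
    rw [AddCircle.toCircle_apply_mk, Circle.coe_exp]
    have := Complex.norm_mul_exp_arg_mul_I z
    rw [hz1] at this
    have hpi : (2 * Real.pi / (2 * Real.pi)) = 1 := div_self Real.two_pi_pos.ne'
    rw [hpi]
    simpa using this
  have h1 : ‖g x - t x‖ ≤ ε := by
    rw [← dist_eq_norm]
    exact (ContinuousMap.dist_apply_le_dist x).trans htg.le
  have h2 : g x = s z := by rw [← hx]; rfl
  rw [h2] at h1
  have h3 := hp x
  rw [hx] at h3
  rw [← h3, ← mul_sub, norm_mul, norm_pow, hz1]
  simpa using h1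

lemma disk_approx (f : ℂ → ℂ) (hf : MemA f) (ε : ℝ) (hε : 0 < ε) :
    ∃ p : Polynomial ℂ, ∀ z ∈ Disk, ‖f z - p.eval z‖ ≤ ε := by
  obtain ⟨hc, hd⟩ := hf
  have huc := (isCompact_closedBall (0:ℂ) 1).uniformContinuousOn_of_continuous hc
  rw [Metric.uniformContinuousOn_iff] at huc
  obtain ⟨η, hη, hu⟩ := huc (ε / 2) (by positivity)
  obtain ⟨r, hr0, hr1, hrη⟩ : ∃ r : ℝ, 0 < r ∧ r < 1 ∧ 1 - r < η := by
    refine ⟨max (1/2) (1 - η/2), by positivity, max_lt (by norm_num) (by linarith), ?_⟩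
    have := le_max_right (1/2 : ℝ) (1 - η/2)
    linarith
  obtain ⟨r1, hr1a, hr1b⟩ := exists_between hr1
  obtain ⟨r2, hr2a, hr2b⟩ := exists_between hr1b
  lift r1 to NNReal using (hr0.trans hr1a).le
  lift r2 to NNReal using (hr0.trans (hr1a.trans hr2a)).le
  have hps := (hd.mono (closedBall_subset_ball hr2b)).hasFPowerSeriesOnBall
    (by exact_mod_cast hr0.trans (hr1a.trans hr2a))
  have htu := hps.tendstoUniformlyOn (r' := r1) (by exact_mod_cast hr2a)
  rw [Metric.tendstoUniformlyOn_iff] at htu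
  obtain ⟨N, hN⟩ := (htu (ε / 2) (by positivity)).exists
  refine ⟨∑ k ∈ Finset.range N, Polynomial.C ((cauchyPowerSeries f 0 r2).coeff k * (r : ℂ) ^ k) *
    Polynomial.X ^ k, fun z hz => ?_⟩
  have hz1 : ‖z‖ ≤ 1 := by simpa [Disk] using hz
  have hrz : ‖(r : ℂ) * z‖ ≤ r := by
    rw [norm_mul, Complex.norm_real, Real.norm_of_nonneg hr0.le]
    nlinarith
  have h1 := hN ((r : ℂ) * z) (by simpa using hrz.trans_lt hr1a)
  have h2 := hu z hz ((r : ℂ) * z) (by simpa using hrz.trans hr1.le) (by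
    rw [dist_eq_norm]
    have : z - r * z = ((1 - r : ℝ) : ℂ) * z := by push_cast; ring
    rw [this, norm_mul, Complex.norm_real, Real.norm_of_nonneg (by linarith)]
    nlinarith)
  have h3 : (cauchyPowerSeries f 0 r2).partialSum N (r * z) =
      (∑ k ∈ Finset.range N, Polynomial.C ((cauchyPowerSeries f 0 r2).coeff k * (r : ℂ) ^ k) *
        Polynomial.X ^ k).eval z := by
    rw [FormalMultilinearSeries.partialSum, Polynomial.eval_finsetSum]
    refine Finset.sum_congr rfl fun k _ => ?_
    rw [FormalMultilinearSeries.apply_eq_pow_smul_coeff]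
    simp only [Polynomial.eval_mul, Polynomial.eval_pow, Polynomial.eval_X, Polynomial.eval_C,
      smul_eq_mul]
    ring
  rw [← h3, ← dist_eq_norm]
  rw [zero_add] at h1
  have := dist_triangle (f z) (f (r * z)) ((cauchyPowerSeries f 0 r2).partialSum N (r * z))
  linarith

lemma analytic_of_approx (s : ℂ → ℂ) (hs : ContinuousOn s Circ)
    (H : ∀ ε : ℝ, 0 < ε → ∃ (f : ℂ → ℂ) (fb : ℝ → ℂ), MemHinf f ∧
      (∀ᵐ (θ : ℝ) ∂angMeas, Tendsto (fun r : ℝ => f ((r : ℂ) * Complex.exp (↑θ * Complex.I)))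
        (nhdsWithin 1 (Set.Iio 1)) (nhds (fb θ))) ∧
      ∀ᵐ (θ : ℝ) ∂angMeas, ‖fb θ - s (Complex.exp (↑θ * Complex.I))‖ ≤ ε) :
    ∃ h : ℂ → ℂ, MemA h ∧ ∀ z ∈ Circ, h z = s z := by
  have hε : ∀ k : ℕ, (0:ℝ) < 1 / ((k : ℝ) + 1) := fun k => by positivity
  choose f fb hf hlim hfs using fun k : ℕ => H (1 / ((k : ℝ) + 1)) (hε k)
  have hexp : ∀ θ : ℝ, Complex.exp (↑θ * Complex.I) ∈ Circ := by
    intro θ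
    simp [Circ, Complex.norm_exp_ofReal_mul_I]
  have hcauchy : ∀ k l : ℕ, ∀ z ∈ ball (0:ℂ) 1,
      ‖f k z - f l z‖ ≤ 1 / ((k : ℝ) + 1) + 1 / ((l : ℝ) + 1) := by
    intro k l z hz
    obtain ⟨B1, hB1⟩ := (hf k).2
    obtain ⟨B2, hB2⟩ := (hf l).2
    refine maxPrinciple (fun z => f k z - f l z) ((hf k).1.sub (hf l).1) (B1 + B2)
      (fun w hw => (norm_sub_le _ _).trans (add_le_add (hB1 w hw) (hB2 w hw)))
      (fun θ => fb k θ - fb l θ) ?_ _ (add_pos (hε k) (hε l)) ?_ z hz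
    · filter_upwards [hlim k, hlim l] with θ h1 h2
      exact h1.sub h2
    · filter_upwards [hfs k, hfs l] with θ h1 h2
      have h3 : fb k θ - fb l θ = (fb k θ - s (Complex.exp (↑θ * Complex.I))) -
        (fb l θ - s (Complex.exp (↑θ * Complex.I))) := by ring
      rw [h3]
      exact (norm_sub_le _ _).trans (add_le_add h1 h2)
  have hten0 : Tendsto (fun k : ℕ => 1 / ((k : ℝ) + 1)) atTop (nhds 0) :=
    tendsto_one_div_add_atTop_nhds_zero_nat
  have hconv : ∀ z ∈ ball (0:ℂ) 1, ∃ L, Tendsto (fun k => f k z) atTop (nhds L) := by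
    intro z hz
    refine cauchySeq_tendsto_of_complete ?_
    refine cauchySeq_of_le_tendsto_0' (fun k : ℕ => 2 * (1 / ((k : ℝ) + 1))) ?_ ?_
    · intro k l hkl
      rw [dist_eq_norm]
      refine (hcauchy k l z hz).trans ?_
      have : 1 / ((l : ℝ) + 1) ≤ 1 / ((k : ℝ) + 1) := by gcongr
      linarith
    · simpa using hten0.const_mul 2
  choose! F hF using hconv
  have hFk : ∀ k, ∀ z ∈ ball (0:ℂ) 1, ‖F z - f k z‖ ≤ 1 / ((k : ℝ) + 1) := by
    intro k z hz
    have h1 : Tendsto (fun l => ‖f l z - f k z‖) atTop (nhds ‖F z - f k z‖) :=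
      ((hF z hz).sub_const _).norm
    have h2 : Tendsto (fun l : ℕ => 1 / ((l : ℝ) + 1) + 1 / ((k : ℝ) + 1)) atTop
        (nhds (0 + 1 / ((k : ℝ) + 1))) := hten0.add_const _
    rw [zero_add] at h2
    exact le_of_tendsto_of_tendsto' h1 h2 fun l => hcauchy l k z hz
  have hFd : DifferentiableOn ℂ F (ball (0:ℂ) 1) := by
    have hu : TendstoUniformlyOn f F atTop (ball (0:ℂ) 1) := by
      rw [Metric.tendstoUniformlyOn_iff]
      intro ε hε
      filter_upwards [hten0.eventually (gt_mem_nhds hε)] with k hk z hz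
      rw [dist_eq_norm]
      exact (hFk k z hz).trans_lt hk
    exact hu.tendstoLocallyUniformlyOn.differentiableOn
      (Eventually.of_forall fun k => (hf k).1) isOpen_ball
  have hball : ∀ z ∈ Circ, z ∉ ball (0:ℂ) 1 := by
    intro z hz hz'
    have h1 : ‖z‖ = 1 := by simpa [Circ] using hz
    have h2 : ‖z‖ < 1 := by simpa using hz'
    linarith
  classical
  let h : ℂ → ℂ := fun z => if z ∈ ball (0:ℂ) 1 then F z else s z
  have hhF : ∀ z ∈ ball (0:ℂ) 1, h z = F z := fun z hz => if_pos hz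
  have hhs : ∀ z ∈ Circ, h z = s z := fun z hz => if_neg (hball z hz)
  have happ : ∀ (m : ℕ) (p : Polynomial ℂ) (ε : ℝ), 0 < ε →
      (∀ z ∈ Circ, ‖z ^ m * s z - p.eval z‖ ≤ ε) →
      ∀ z ∈ Disk, ‖z ^ m * h z - p.eval z‖ ≤ ε := by
    intro m p ε hε' hp z hz
    by_cases hzb : z ∈ ball (0:ℂ) 1
    · rw [hhF z hzb]
      have h1 : Tendsto (fun k => ‖z ^ m * f k z - p.eval z‖) atTop
          (nhds ‖z ^ m * F z - p.eval z‖) :=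
        (((hF z hzb).const_mul _).sub_const _).norm
      have h2 : Tendsto (fun k : ℕ => 1 / ((k : ℝ) + 1) + ε) atTop (nhds (0 + ε)) :=
        hten0.add_const _
      rw [zero_add] at h2
      refine le_of_tendsto_of_tendsto' h1 h2 fun k => ?_
      obtain ⟨B1, hB1⟩ := (hf k).2
      obtain ⟨B2, hB2⟩ := (isCompact_closedBall (0:ℂ) 1).exists_bound_of_continuousOn
        p.continuous.continuousOn
      have hnn : ∀ w ∈ ball (0:ℂ) 1, ‖w ^ m‖ ≤ 1 := by
        intro w hw
        rw [norm_pow]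
        exact pow_le_one₀ (norm_nonneg _) (by simpa using (mem_ball_zero_iff.1 hw).le)
      refine maxPrinciple (fun z => z ^ m * f k z - p.eval z) ?_ (1 * B1 + B2) ?_
        (fun θ => Complex.exp (↑θ * Complex.I) ^ m * fb k θ -
          p.eval (Complex.exp (↑θ * Complex.I))) ?_ _ (add_pos (hε k) hε') ?_ z hzb
      · exact ((differentiableOn_id.pow m).mul (hf k).1).sub p.differentiable.differentiableOn
      · intro w hw
        refine (norm_sub_le _ _).trans (add_le_add ?_ (hB2 w (ball_subset_closedBall hw)))
        rw [norm_mul]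
        exact mul_le_mul (hnn w hw) (hB1 w hw) (norm_nonneg _) zero_le_one
      · filter_upwards [hlim k] with θ hθ
        have hr : Tendsto (fun r : ℝ => (r : ℂ) * Complex.exp (↑θ * Complex.I))
            (nhdsWithin 1 (Set.Iio 1)) (nhds (Complex.exp (↑θ * Complex.I))) := by
          have hc : Continuous (fun r : ℝ => (r : ℂ) * Complex.exp (↑θ * Complex.I)) := by fun_prop
          have := hc.tendsto 1
          simp only [Complex.ofReal_one, one_mul] at this
          exact tendsto_nhdsWithin_of_tendsto_nhds this
        exact ((hr.pow m).mul hθ).sub ((p.continuous.tendsto _).comp hr)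
      · filter_upwards [hfs k] with θ hθ
        set e := Complex.exp (↑θ * Complex.I) with he
        have hen : ‖e‖ = 1 := Complex.norm_exp_ofReal_mul_I θ
        have h3 : e ^ m * fb k θ - p.eval e = e ^ m * (fb k θ - s e) +
          (e ^ m * s e - p.eval e) := by ring
        rw [h3]
        refine (norm_add_le _ _).trans (add_le_add ?_ (hp e (hexp θ)))
        rw [norm_mul, norm_pow, hen]
        simpa using hθ
    · have hzc : z ∈ Circ := by
        have h1 : ‖z‖ ≤ 1 := by simpa [Disk] using hz
        have h2 : ¬ ‖z‖ < 1 := by simpa using hzb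
        have : ‖z‖ = 1 := le_antisymm h1 (not_lt.1 h2)
        simpa [Circ] using this
      rw [hhs z hzc]
      exact hp z hzc
  refine ⟨h, ⟨?_, hFd.congr hhF⟩, hhs⟩
  intro z0 hz0
  by_cases hzb : z0 ∈ ball (0:ℂ) 1
  · have h1 : ContinuousAt F z0 := hFd.continuousOn.continuousAt (isOpen_ball.mem_nhds hzb)
    have h2 : h =ᶠ[nhds z0] F := by
      filter_upwards [isOpen_ball.mem_nhds hzb] with w hw using hhF w hw
    exact (h1.congr h2.symm).continuousWithinAt
  · have hz1 : ‖z0‖ = 1 := by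
      have h1 : ‖z0‖ ≤ 1 := by simpa [Disk] using hz0
      have h2 : ¬ ‖z0‖ < 1 := by simpa using hzb
      exact le_antisymm h1 (not_lt.1 h2)
    have hz0' : z0 ≠ 0 := by
      rintro rfl
      simp at hz1
    refine continuousWithinAt_of_locally_uniform_approx_of_continuousWithinAt hz0 ?_
    intro u hu
    obtain ⟨ε, hε', hεu⟩ := Metric.mem_uniformity_dist.1 hu
    obtain ⟨m, p, hp⟩ := trig_dense s hs (ε / 4) (by positivity)
    have hev : ∀ᶠ w in nhds z0, 1 / 2 < ‖w‖ ^ m := by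
      have hc : Continuous (fun w : ℂ => ‖w‖ ^ m) := by fun_prop
      refine hc.continuousAt.eventually (lt_mem_nhds ?_)
      simp only [hz1, one_pow]; norm_num
    refine ⟨{w | 1 / 2 < ‖w‖ ^ m} ∩ Disk, ?_, fun w => p.eval w / w ^ m, ?_, ?_⟩
    · exact inter_mem (nhdsWithin_le_nhds hev) self_mem_nhdsWithin
    · refine ContinuousAt.continuousWithinAt ?_
      exact p.continuous.continuousAt.div (continuousAt_id.pow m) (pow_ne_zero _ hz0')
    · rintro w ⟨hw1, hw2⟩
      apply hεu
      have hw1' : 1 / 2 < ‖w ^ m‖ := by rw [norm_pow]; exact hw1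
      have hwm : w ^ m ≠ 0 := by
        rw [← norm_pos_iff]; linarith
      have h3 : h w - p.eval w / w ^ m = (w ^ m * h w - p.eval w) / w ^ m := by
        field_simp
      rw [dist_eq_norm, h3, norm_div, div_lt_iff₀ (by linarith)]
      have := happ m p (ε / 4) (by positivity) hp w hw2
      nlinarith

lemma norm_le_euclNorm {n : ℕ} (w : Fin n → ℂ) : ‖w‖ ≤ euclNorm w := by
  refine (pi_norm_le_iff_of_nonneg (Real.sqrt_nonneg _)).2 fun j => ?_
  rw [← Real.sqrt_sq (norm_nonneg (w j))]
  refine Real.sqrt_le_sqrt ?_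
  rw [← Complex.normSq_eq_norm_sq]
  exact Finset.single_le_sum (f := fun j => Complex.normSq (w j))
    (fun i _ => Complex.normSq_nonneg _) (Finset.mem_univ j)

lemma isCompact_Circ : IsCompact Circ := isCompact_sphere _ _

lemma exp_mem_Circ (θ : ℝ) : Complex.exp (↑θ * Complex.I) ∈ Circ := by
  simp [Circ, Complex.norm_exp_ofReal_mul_I]

lemma near_S {n : ℕ} {ρ : ℂ → (Fin n → ℂ) → ℝ} {R : ℝ} {S : ℂ → Fin n → ℂ}
    (hρ : Cond3 n ρ R S) (ε : ℝ) :
    ε > 0 → ∃ c > (0:ℝ), ∀ z ∈ Circ, ∀ w, ρ z w ≤ c → ‖w - S z‖ ≤ ε := by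
  intro hε
  have hK : IsCompact (Circ ×ˢ closedBall (0 : Fin n → ℂ) R) :=
    isCompact_Circ.prod (isCompact_closedBall _ _)
  have hg : ContinuousOn (fun p : ℂ × (Fin n → ℂ) => ‖p.2 - S p.1‖)
      (Circ ×ˢ closedBall (0 : Fin n → ℂ) R) := by
    refine ContinuousOn.norm (continuousOn_snd.sub ?_)
    exact hρ.Scont.comp continuousOn_fst fun p hp => hp.1
  have hK2 : IsCompact ((Circ ×ˢ closedBall (0 : Fin n → ℂ) R) ∩
      (fun p : ℂ × (Fin n → ℂ) => ‖p.2 - S p.1‖) ⁻¹' Set.Ici ε) :=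
    hK.of_isClosed_subset (hg.preimage_isClosed_of_isClosed hK.isClosed isClosed_Ici)
      Set.inter_subset_left
  set K := ((Circ ×ˢ closedBall (0 : Fin n → ℂ) R) ∩
      (fun p : ℂ × (Fin n → ℂ) => ‖p.2 - S p.1‖) ⁻¹' Set.Ici ε) with hKdef
  have hR0 : 0 < R := zero_lt_one.trans hρ.hR
  have hwR : ∀ z ∈ Circ, ∀ w, ρ z w ≤ R → w ∈ closedBall (0 : Fin n → ℂ) R := by
    intro z hz w hw
    rw [mem_closedBall_zero_iff]
    refine (norm_le_euclNorm w).trans ?_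
    by_contra! hlt
    linarith [hρ.aboveR z hz w hlt]
  rcases K.eq_empty_or_nonempty with hE | hNE
  · refine ⟨R, hR0, fun z hz w hw => ?_⟩
    by_contra! hlt
    have : (z, w) ∈ K := ⟨⟨hz, hwR z hz w hw⟩, hlt.le⟩
    rw [hE] at this
    exact this
  · obtain ⟨p0, hp0, hmin⟩ := hK2.exists_isMinOn hNE (hρ.cont.mono fun p hp => hp.1.1)
    have hpos : 0 < ρ p0.1 p0.2 := by
      refine lt_of_le_of_ne (hρ.nonneg p0.1 hp0.1.1 p0.2) fun h0 => ?_
      have h1 := (hρ.Szero p0.1 hp0.1.1 p0.2).1 h0.symm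
      have h2 : ε ≤ ‖p0.2 - S p0.1‖ := hp0.2
      rw [h1, sub_self, norm_zero] at h2
      linarith
    refine ⟨min R (ρ p0.1 p0.2 / 2), by positivity, fun z hz w hw => ?_⟩
    by_contra! hlt
    have hm : (z, w) ∈ K := ⟨⟨hz, hwR z hz w (hw.trans (min_le_left _ _))⟩, hlt.le⟩
    have h3 : ρ p0.1 p0.2 ≤ ρ z w := hmin hm
    have h4 := hw.trans (min_le_right _ _)
    linarith

lemma rho_perturb {n : ℕ} {ρ : ℂ → (Fin n → ℂ) → ℝ} {R : ℝ} {S : ℂ → Fin n → ℂ}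
    (hρ : Cond3 n ρ R S) (g : ℂ → Fin n → ℂ) (hg : ContinuousOn g Circ) (c d : ℝ) (hcd : c < d)
    (hc : ∀ z ∈ Circ, ρ z (g z) ≤ c) :
    ∃ η > (0:ℝ), ∀ z ∈ Circ, ∀ w, ‖w - g z‖ ≤ η → ρ z w < d := by
  obtain ⟨B, hB⟩ := isCompact_Circ.exists_bound_of_continuousOn hg
  have hK : IsCompact (Circ ×ˢ closedBall (0 : Fin n → ℂ) (B + 1)) :=
    isCompact_Circ.prod (isCompact_closedBall _ _)
  have hu := hK.uniformContinuousOn_of_continuous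
    (hρ.cont.mono (fun p hp => hp.1) : ContinuousOn (fun p : ℂ × (Fin n → ℂ) => ρ p.1 p.2) _)
  rw [Metric.uniformContinuousOn_iff] at hu
  obtain ⟨η, hη, hu⟩ := hu (d - c) (by linarith)
  refine ⟨min (η / 2) 1, by positivity, fun z hz w hw => ?_⟩
  have h1 : ‖w - g z‖ ≤ 1 := hw.trans (min_le_right _ _)
  have h2 : ‖w - g z‖ ≤ η / 2 := hw.trans (min_le_left _ _)
  have h3 : ‖w‖ ≤ B + 1 := by
    have : w = g z + (w - g z) := by abel
    rw [this]
    exact (norm_add_le _ _).trans (add_le_add (hB z hz) h1)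
  have h4 := hu (z, w) ⟨hz, by simpa using h3⟩ (z, g z)
    ⟨hz, by simpa using (hB z hz).trans (by linarith)⟩ (by
      rw [Prod.dist_eq, dist_self, dist_eq_norm]
      exact max_lt hη (by simp only; linarith))
  rw [Real.dist_eq] at h4
  have h5 := (abs_lt.1 h4).2
  simp only at h5
  linarith [hc z hz]

lemma harm_of_poly {n : ℕ} (m : ℕ) (p : Fin n → Polynomial ℂ) :
    ∃ q : ℂ → Fin n → ℂ, HarmPolyTuple q ∧ ∀ z ∈ Circ, ∀ j, z ^ m * q z j = (p j).eval z := by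
  obtain ⟨d, hmd, hd⟩ : ∃ d : ℕ, m ≤ d ∧ ∀ j, (p j).natDegree ≤ d := by
    refine ⟨m + ∑ j, (p j).natDegree, by omega, fun j => ?_⟩
    have := Finset.single_le_sum (f := fun j => (p j).natDegree) (fun i _ => Nat.zero_le _)
      (Finset.mem_univ j)
    omega
  let a : ℕ → Fin n → ℂ := fun i j => (p j).coeff (m + i)
  let b : ℕ → Fin n → ℂ := fun i j => if 1 ≤ i ∧ i ≤ m then (p j).coeff (m - i) else 0
  refine ⟨fun z j => ∑ i ∈ Finset.range (d+1), (a i j * z ^ i + b i j * (starRingEnd ℂ z) ^ i),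
    ⟨d, a, b, fun z j => rfl⟩, fun z hz j => ?_⟩
  have hz1 : ‖z‖ = 1 := by simpa [Circ] using hz
  have hzz : z * (starRingEnd ℂ) z = 1 := by
    rw [Complex.mul_conj, Complex.normSq_eq_norm_sq, hz1]; simp
  beta_reduce
  rw [Polynomial.eval_eq_sum_range' (n := m + (d + 1)) (by have := hd j; omega),
    Finset.sum_range_add _ m (d + 1), Finset.sum_add_distrib, mul_add, add_comm]
  congr 1
  · obtain ⟨e, rfl⟩ := Nat.exists_eq_add_of_le hmd
    have h0 : m + e + 1 = (m + 1) + e := by omega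
    rw [h0, Finset.sum_range_add _ (m + 1) e, Finset.sum_range_succ']
    have h1 : ∑ x ∈ Finset.range e, b (m + 1 + x) j * (starRingEnd ℂ) z ^ (m + 1 + x) = 0 := by
      refine Finset.sum_eq_zero fun x _ => ?_
      have : ¬ (1 ≤ m + 1 + x ∧ m + 1 + x ≤ m) := by omega
      simp [b, this]
    have h2 : b 0 j = 0 := by simp [b]
    rw [h1, h2, zero_mul, add_zero, add_zero, Finset.mul_sum, ← Finset.sum_range_reflect]
    refine Finset.sum_congr rfl fun i hi => ?_
    rw [Finset.mem_range] at hi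
    have h3 : (1 ≤ m - 1 - i + 1 ∧ m - 1 - i + 1 ≤ m) := by omega
    have h4 : m - (m - 1 - i + 1) = i := by omega
    simp only [b, h3, and_self, if_true, h4]
    have h5 : m = i + (m - 1 - i + 1) := by omega
    have h6 : z ^ m = z ^ i * z ^ (m - 1 - i + 1) := by rw [← pow_add, ← h5]
    have h7 : z ^ (m - 1 - i + 1) * (starRingEnd ℂ) z ^ (m - 1 - i + 1) = 1 := by
      rw [← mul_pow, hzz, one_pow]
    rw [h6]
    linear_combination (z ^ i * (p j).coeff i) * h7
  · rw [Finset.mul_sum]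
    refine Finset.sum_congr rfl fun i _ => ?_
    simp only [a]
    ring

lemma radial_tendsto (θ : ℝ) : Tendsto (fun r : ℝ => (r : ℂ) * Complex.exp (↑θ * Complex.I))
    (nhdsWithin 1 (Set.Iio 1)) (nhds (Complex.exp (↑θ * Complex.I))) := by
  have hc : Continuous (fun r : ℝ => (r : ℂ) * Complex.exp (↑θ * Complex.I)) := by fun_prop
  have := hc.tendsto 1
  simp only [Complex.ofReal_one, one_mul] at this
  exact tendsto_nhdsWithin_of_tendsto_nhds this

lemma angMeas_exists {P : ℝ → Prop} (h : ∀ᵐ (θ : ℝ) ∂angMeas, P θ) : ∃ θ, P θ := by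
  have hne : (ae angMeas).NeBot := by
    rw [ae_neBot]
    intro h0
    have := Measure.restrict_eq_zero.1 h0
    simp at this
    linarith [Real.pi_pos]
  exact h.exists

lemma MemA.memHinf {f : ℂ → ℂ} (hf : MemA f) : MemHinf f := by
  refine ⟨hf.2, ?_⟩
  obtain ⟨B, hB⟩ := (isCompact_closedBall (0:ℂ) 1).exists_bound_of_continuousOn hf.1
  exact ⟨B, fun z hz => hB z (ball_subset_closedBall hz)⟩

lemma MemAV.bdry {n : ℕ} {f : ℂ → Fin n → ℂ} (hf : MemAV f) : IsBdryVal f f := by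
  refine Eventually.of_forall fun θ => ?_
  rw [tendsto_pi_nhds]
  intro j
  have hmem : Complex.exp (↑θ * Complex.I) ∈ Disk := sphere_subset_closedBall (exp_mem_Circ θ)
  have h1 : Tendsto (fun z => f z j) (nhdsWithin (Complex.exp (↑θ * Complex.I)) Disk)
      (nhds (f (Complex.exp (↑θ * Complex.I)) j)) := (hf j).1 _ hmem
  refine h1.comp (tendsto_nhdsWithin_iff.2 ⟨radial_tendsto θ, ?_⟩)
  have h2 : ∀ᶠ r : ℝ in nhdsWithin 1 (Set.Iio 1), r < 1 := self_mem_nhdsWithin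
  have h3 : ∀ᶠ r : ℝ in nhdsWithin 1 (Set.Iio 1), 0 < r :=
    nhdsWithin_le_nhds (lt_mem_nhds zero_lt_one)
  filter_upwards [h2, h3] with r hr hr0
  simp [Disk, Complex.norm_exp_ofReal_mul_I, abs_of_pos hr0, hr.le]

lemma MemA_pow_mul {f : ℂ → ℂ} (hf : MemA f) (m : ℕ) : MemA (fun z => z ^ m * f z) :=
  ⟨(continuousOn_id.pow m).mul hf.1, (differentiableOn_id.pow m).mul hf.2⟩

lemma MemHinf_pow_mul {f : ℂ → ℂ} (hf : MemHinf f) (m : ℕ) : MemHinf (fun z => z ^ m * f z) := by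
  obtain ⟨hd, B, hB⟩ := hf
  refine ⟨(differentiableOn_id.pow m).mul hd, B, fun w hw => ?_⟩
  rw [norm_mul, norm_pow]
  have h1 : ‖w‖ ^ m ≤ 1 := pow_le_one₀ (norm_nonneg _) (mem_ball_zero_iff.1 hw).le
  calc ‖w‖ ^ m * ‖f w‖ ≤ 1 * ‖f w‖ := by gcongr
    _ ≤ B := by simpa using hB w hw

lemma MemA_poly (p : Polynomial ℂ) : MemA (fun z => p.eval z) :=
  ⟨p.continuous.continuousOn, p.differentiable.differentiableOn⟩

lemma ne_zero_of_Circ {z : ℂ} (hz : z ∈ Circ) : z ≠ 0 := by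
  rintro rfl
  simp [Circ] at hz

lemma rhoShift_pow_mul {n : ℕ} (ρ : ℂ → (Fin n → ℂ) → ℝ) (m : ℕ) {z : ℂ} (hz : z ∈ Circ)
    (w : Fin n → ℂ) : rhoShift ρ m z (fun j => z ^ m * w j) = ρ z w := by
  have h := pow_ne_zero m (ne_zero_of_Circ hz)
  simp only [rhoShift]
  congr 1
  funext j
  field_simp

section
variable {n : ℕ} {ρ : ℂ → (Fin n → ℂ) → ℝ}

lemma delta_bdd (h0 : ∀ z ∈ Circ, ∀ w, 0 ≤ ρ z w) :
    BddBelow {c : ℝ | ∃ f : ℂ → Fin n → ℂ, MemAV f ∧ ∀ z ∈ Circ, ρ z (f z) ≤ c} := by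
  refine ⟨0, ?_⟩
  rintro c ⟨f, -, hf⟩
  have h1 : (1:ℂ) ∈ Circ := by simp [Circ]
  exact (h0 1 h1 _).trans (hf 1 h1)

lemma gamma_bdd (h0 : ∀ z ∈ Circ, ∀ w, 0 ≤ ρ z w) :
    0 ∈ lowerBounds {c : ℝ | ∃ f fb : ℂ → Fin n → ℂ, MemHinfV f ∧ IsBdryVal f fb ∧
    ∀ᵐ (θ : ℝ) ∂(volume.restrict (Set.Ioc (0:ℝ) (2 * Real.pi))),
      ρ (Complex.exp (↑θ * Complex.I)) (fb (Complex.exp (↑θ * Complex.I))) ≤ c} := by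
  rintro c ⟨f, fb, -, -, hf⟩
  obtain ⟨θ, hθ⟩ := angMeas_exists hf
  exact (h0 _ (exp_mem_Circ θ) _).trans hθ

lemma delta_nonempty {R : ℝ} {S : ℂ → Fin n → ℂ} (hρ : Cond3 n ρ R S) :
    {c : ℝ | ∃ f : ℂ → Fin n → ℂ, MemAV f ∧ ∀ z ∈ Circ, ρ z (f z) ≤ c}.Nonempty := by
  have hc : ContinuousOn (fun z : ℂ => ρ z 0) Circ :=
    hρ.cont.comp (f := fun z : ℂ => (z, (0 : Fin n → ℂ)))
      (by fun_prop) fun z hz => hz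
  obtain ⟨B, hB⟩ := isCompact_Circ.exists_bound_of_continuousOn hc
  refine ⟨B, fun _ => 0, fun j => ⟨continuousOn_const, differentiableOn_const _⟩, fun z hz => ?_⟩
  exact (le_abs_self _).trans (hB z hz)

lemma delta_sub (m : ℕ) :
    {c : ℝ | ∃ f : ℂ → Fin n → ℂ, MemAV f ∧ ∀ z ∈ Circ, ρ z (f z) ≤ c} ⊆
    {c : ℝ | ∃ f : ℂ → Fin n → ℂ, MemAV f ∧ ∀ z ∈ Circ, rhoShift ρ m z (f z) ≤ c} := by
  rintro c ⟨f, hf, hfc⟩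
  refine ⟨fun z j => z ^ m * f z j, fun j => MemA_pow_mul (hf j) m, fun z hz => ?_⟩
  rw [rhoShift_pow_mul ρ m hz]
  exact hfc z hz

lemma delta_gamma_sub :
    {c : ℝ | ∃ f : ℂ → Fin n → ℂ, MemAV f ∧ ∀ z ∈ Circ, ρ z (f z) ≤ c} ⊆
    {c : ℝ | ∃ f fb : ℂ → Fin n → ℂ, MemHinfV f ∧ IsBdryVal f fb ∧
    ∀ᵐ (θ : ℝ) ∂(volume.restrict (Set.Ioc (0:ℝ) (2 * Real.pi))),
      ρ (Complex.exp (↑θ * Complex.I)) (fb (Complex.exp (↑θ * Complex.I))) ≤ c} := by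
  rintro c ⟨f, hf, hfc⟩
  exact ⟨f, f, fun j => (hf j).memHinf, hf.bdry,
    Eventually.of_forall fun θ => hfc _ (exp_mem_Circ θ)⟩

lemma gamma_sub (m : ℕ) :
    {c : ℝ | ∃ f fb : ℂ → Fin n → ℂ, MemHinfV f ∧ IsBdryVal f fb ∧
    ∀ᵐ (θ : ℝ) ∂(volume.restrict (Set.Ioc (0:ℝ) (2 * Real.pi))),
      ρ (Complex.exp (↑θ * Complex.I)) (fb (Complex.exp (↑θ * Complex.I))) ≤ c} ⊆
    {c : ℝ | ∃ f fb : ℂ → Fin n → ℂ, MemHinfV f ∧ IsBdryVal f fb ∧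
    ∀ᵐ (θ : ℝ) ∂(volume.restrict (Set.Ioc (0:ℝ) (2 * Real.pi))),
      rhoShift ρ m (Complex.exp (↑θ * Complex.I)) (fb (Complex.exp (↑θ * Complex.I))) ≤ c} := by
  rintro c ⟨f, fb, hf, hb, hfc⟩
  refine ⟨fun z j => z ^ m * f z j, fun z j => z ^ m * fb z j,
    fun j => MemHinf_pow_mul (hf j) m, ?_, ?_⟩
  · filter_upwards [hb] with θ hθ
    rw [tendsto_pi_nhds] at hθ ⊢
    intro j
    exact ((radial_tendsto θ).pow m).mul (hθ j)
  · filter_upwards [hfc] with θ hθ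
    rw [rhoShift_pow_mul ρ m (exp_mem_Circ θ)]
    exact hθ

lemma gamma_pos {R : ℝ} {S : ℂ → Fin n → ℂ} (hρ : Cond3 n ρ R S) (hna : ¬ BoundaryAnalytic S) :
    0 < gammaRho ρ := by
  by_contra! hle
  apply hna
  have hne := (delta_nonempty hρ).mono delta_gamma_sub
  have H : ∀ ε : ℝ, 0 < ε → ∃ f fb : ℂ → Fin n → ℂ, MemHinfV f ∧ IsBdryVal f fb ∧
      ∀ᵐ (θ : ℝ) ∂angMeas,
        ‖fb (Complex.exp (↑θ * Complex.I)) - S (Complex.exp (↑θ * Complex.I))‖ ≤ ε := by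
    intro ε hε
    obtain ⟨c, hc, hcS⟩ := near_S hρ ε hε
    obtain ⟨c', ⟨f, fb, hf, hb, hfc⟩, hlt⟩ := exists_lt_of_csInf_lt hne (hle.trans_lt hc)
    refine ⟨f, fb, hf, hb, ?_⟩
    filter_upwards [hfc] with θ hθ
    exact hcS _ (exp_mem_Circ θ) _ (hθ.trans hlt.le)
  have hj : ∀ j : Fin n, ∃ h : ℂ → ℂ, MemA h ∧ ∀ z ∈ Circ, h z = S z j := by
    intro j
    refine analytic_of_approx (fun z => S z j) (continuousOn_pi.1 hρ.Scont j) fun ε hε => ?_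
    obtain ⟨f, fb, hf, hb, hfc⟩ := H ε hε
    refine ⟨fun z => f z j, fun θ => fb (Complex.exp (↑θ * Complex.I)) j, hf j, ?_, ?_⟩
    · filter_upwards [hb] with θ hθ
      exact (tendsto_pi_nhds.1 hθ) j
    · filter_upwards [hfc] with θ hθ
      exact (norm_le_pi_norm (fb (Complex.exp (↑θ * Complex.I)) -
        S (Complex.exp (↑θ * Complex.I))) j).trans hθ
  choose h hA hS using hj
  exact ⟨fun z j => h j z, hA, fun z hz => funext fun j => hS j z hz⟩

lemma exists_shift {R : ℝ} {S : ℂ → Fin n → ℂ} (hρ : Cond3 n ρ R S) (hδ : 0 < deltaRho ρ) :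
    ∃ m : ℕ, 0 < m ∧ deltaRho (rhoShift ρ m) < deltaRho ρ := by
  obtain ⟨η, hη, hpert⟩ := rho_perturb hρ S hρ.Scont 0 (deltaRho ρ / 2) (by linarith)
    (fun z hz => ((hρ.Szero z hz _).2 rfl).le)
  choose m p hp using fun j : Fin n =>
    trig_dense (fun z => S z j) (continuousOn_pi.1 hρ.Scont j) η hη
  let N : ℕ := 1 + ∑ j, m j
  have hmN : ∀ j, m j ≤ N := by
    intro j
    have := Finset.single_le_sum (f := m) (fun i _ => Nat.zero_le _) (Finset.mem_univ j)
    omega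
  refine ⟨N, by omega, ?_⟩
  refine lt_of_le_of_lt (csInf_le (delta_bdd fun z hz w => hρ.nonneg z hz _)
    (?_ : deltaRho ρ / 2 ∈ _)) (by linarith)
  refine ⟨fun z j => z ^ (N - m j) * (p j).eval z,
    fun j => MemA_pow_mul (MemA_poly (p j)) _, fun z hz => ?_⟩
  refine (hpert z hz _ ?_).le
  rw [pi_norm_le_iff_of_nonneg hη.le]
  intro j
  have hz0 := ne_zero_of_Circ hz
  have hz1 : ‖z‖ = 1 := by simpa [Circ] using hz
  have h1 : z ^ N = z ^ (N - m j) * z ^ (m j) := by rw [← pow_add, Nat.sub_add_cancel (hmN j)]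
  have h2 : z ^ (N - m j) * (p j).eval z / z ^ N - S z j =
      - (z ^ (m j) * S z j - (p j).eval z) / z ^ (m j) := by
    rw [h1]
    field_simp
    ring
  rw [Pi.sub_apply, h2, norm_div, norm_neg, norm_pow, hz1, one_pow, div_one]
  exact hp j z hz

lemma exists_harm {R : ℝ} {S : ℂ → Fin n → ℂ} (hρ : Cond3 n ρ R S) (m : ℕ)
    (hm : deltaRho (rhoShift ρ m) < deltaRho ρ) :
    ∃ q : ℂ → Fin n → ℂ, HarmPolyTuple q ∧
        (∀ z ∈ Circ, ρ z (q z) < deltaRho ρ) ∧ ZmAnalytic m q := by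
  obtain ⟨c, ⟨f, hf, hfc⟩, hlt⟩ :=
    exists_lt_of_csInf_lt ((delta_nonempty hρ).mono (delta_sub m)) hm
  have hg : ContinuousOn (fun z => fun j => f z j / z ^ m) Circ := by
    rw [continuousOn_pi]
    intro j
    exact ((hf j).1.mono sphere_subset_closedBall).div (continuousOn_id.pow m)
      fun z hz => pow_ne_zero _ (ne_zero_of_Circ hz)
  obtain ⟨η, hη, hpert⟩ := rho_perturb hρ _ hg c _ hlt hfc
  choose p hp using fun j : Fin n => disk_approx (fun z => f z j) (hf j) η hη
  obtain ⟨q, hq, hqp⟩ := harm_of_poly m p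
  refine ⟨q, hq, fun z hz => ?_, fun j => ⟨p j, fun z hz => hqp z hz j⟩⟩
  refine hpert z hz _ ?_
  rw [pi_norm_le_iff_of_nonneg hη.le]
  intro j
  have hz0 := pow_ne_zero m (ne_zero_of_Circ hz)
  have hz1 : ‖z‖ = 1 := by simpa [Circ] using hz
  have h2 : q z j - f z j / z ^ m = - (f z j - (p j).eval z) / z ^ m := by
    rw [← hqp z hz j]
    field_simp
    ring
  rw [Pi.sub_apply, h2, norm_div, norm_neg, norm_pow, hz1, one_pow, div_one]
  exact hp j z (sphere_subset_closedBall hz)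

end

/-- comparison of the optimal controls `γ_{ρ_m}, δ_{ρ_m}` with
`γ_ρ, δ_ρ`, and existence of the harmonic polynomial selector `q`. -/
theorem statement16 {n : ℕ} (ρ : ℂ → (Fin n → ℂ) → ℝ) (R : ℝ) (S : ℂ → Fin n → ℂ)
    (hρ : Cond3 n ρ R S) (hna : ¬ BoundaryAnalytic S) :
    (0 < gammaRho ρ ∧ gammaRho ρ ≤ deltaRho ρ) ∧
    (∀ m : ℕ, 0 < m →
      deltaRho (rhoShift ρ m) ≤ deltaRho ρ ∧ gammaRho (rhoShift ρ m) ≤ gammaRho ρ) ∧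
    (∃ m : ℕ, 0 < m ∧ deltaRho (rhoShift ρ m) < deltaRho ρ) ∧
    (∀ m : ℕ, 0 < m → deltaRho (rhoShift ρ m) < deltaRho ρ →
      (∀ k : ℕ, 0 < k → k < m → ¬ deltaRho (rhoShift ρ k) < deltaRho ρ) →
      1 ≤ m ∧ ∃ q : ℂ → Fin n → ℂ, HarmPolyTuple q ∧
        (∀ z ∈ Circ, ρ z (q z) < deltaRho ρ) ∧ ZmAnalytic m q) := by
  have hne := delta_nonempty hρ
  have hγ : 0 < gammaRho ρ := gamma_pos hρ hna
  have hγδ : gammaRho ρ ≤ deltaRho ρ :=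
    csInf_le_csInf ⟨0, gamma_bdd hρ.nonneg⟩ hne delta_gamma_sub
  refine ⟨⟨hγ, hγδ⟩, fun m _ => ⟨?_, ?_⟩, exists_shift hρ (hγ.trans_le hγδ),
    fun m hm hlt _ => ⟨hm, exists_harm hρ m hlt⟩⟩
  · exact csInf_le_csInf (delta_bdd fun z hz w => hρ.nonneg z hz _) hne (delta_sub m)
  · exact csInf_le_csInf ⟨0, gamma_bdd fun z hz w => hρ.nonneg z hz _⟩
      (hne.mono delta_gamma_sub) (gamma_sub m)
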